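/- Assume in addition that g is locally Hölder continuous of some order β ∈ (0, H). Let (α, β') be a connected component of the open set {t > 0 : X_t > 0} with α > 0 and β' < ∞. Then for every t ∈ [α, β'], X_t = a∫_α^t s^{2H−1}/X_s ds − b∫_α^t X_s ds + σ(g(t) − g(α)), where the integrals are Lebesgue integrals. -/

import Mathlib

open MeasureTheory Filter Set

/-- `X` is a continuous solution on `[0,T]` of the ε-approximating equation
`X_t = X₀ + a ∫₀ᵗ (s+ε)^{2H-1} / (X_s 1_{X_s>0} + ε) ds − b ∫₀ᵗ X_s ds + σ g(t)`. -/
def approxSol (X₀ a b σ H : ℝ) (g : ℝ → ℝ) (T ε : ℝ) (X : ℝ → ℝ) : Prop :=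
  ContinuousOn X (Set.Icc 0 T) ∧
    ∀ t ∈ Set.Icc (0:ℝ) T,
      X t = X₀ + a * (∫ s in (0:ℝ)..t,
            (s + ε) ^ (2 * H - 1) / ((if 0 < X s then X s else 0) + ε))
          - b * (∫ s in (0:ℝ)..t, X s) + σ * g t


noncomputable def Fd (H ε : ℝ) (Y : ℝ → ℝ) (s : ℝ) : ℝ :=
  (s + ε) ^ (2 * H - 1) / ((if 0 < Y s then Y s else 0) + ε)

structure Good (X₀ a b σ H : ℝ) (g : ℝ → ℝ) (ε : ℝ) (Y : ℝ → ℝ) : Prop where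
  cont : ContinuousOn Y (Set.Ici 0)
  eq : ∀ t, 0 ≤ t → Y t = X₀ + a * (∫ s in (0:ℝ)..t, Fd H ε Y s)
          - b * (∫ s in (0:ℝ)..t, Y s) + σ * g t

lemma good_of {X₀ a b σ H : ℝ} {g : ℝ → ℝ} {ε : ℝ} {Y : ℝ → ℝ}
    (h : ∀ T > (0:ℝ), approxSol X₀ a b σ H g T ε Y) : Good X₀ a b σ H g ε Y := by
  refine ⟨?_, ?_⟩
  · intro t ht
    have ht0 : (0:ℝ) ≤ t := ht
    have := (h (t+1) (by linarith)).1 t ⟨ht, by linarith⟩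
    refine this.mono_of_mem_nhdsWithin ?_
    rw [← Set.Ici_inter_Iic]
    exact inter_mem self_mem_nhdsWithin (mem_nhdsWithin_of_mem_nhds (Iic_mem_nhds (by linarith)))
  · intro t ht
    exact (h (t+1) (by linarith)).2 t ⟨ht, by linarith⟩

lemma den_eq (x : ℝ) : (if 0 < x then x else 0) = max x 0 := by
  split_ifs with h
  · rw [max_eq_left h.le]
  · rw [max_eq_right (not_lt.mp h)]

lemma Fd_cont {H ε : ℝ} (hε : 0 < ε) {Y : ℝ → ℝ} (hY : ContinuousOn Y (Set.Ici 0)) :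
    ContinuousOn (Fd H ε Y) (Set.Ici 0) := by
  unfold Fd
  simp only [den_eq]
  refine ContinuousOn.div ?_ ?_ ?_
  · refine ContinuousOn.rpow_const (by fun_prop) ?_
    intro x hx
    left
    have : (0:ℝ) ≤ x := hx
    positivity
  · exact (hY.sup continuousOn_const).add continuousOn_const
  · intro x hx
    have := le_max_right (Y x) 0
    positivity

lemma Fd_nonneg {H ε : ℝ} (hε : 0 < ε) {Y : ℝ → ℝ} {s : ℝ} (hs : 0 ≤ s) : 0 ≤ Fd H ε Y s := by
  unfold Fd
  rw [den_eq]
  have := le_max_right (Y s) 0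
  positivity

lemma ii_of {f : ℝ → ℝ} (hf : ContinuousOn f (Set.Ici 0)) {s t : ℝ} (hs : 0 ≤ s) (ht : 0 ≤ t) :
    IntervalIntegrable f volume s t := by
  apply ContinuousOn.intervalIntegrable
  apply hf.mono
  intro x hx
  exact le_trans (le_min hs ht) hx.1

lemma Good.incr {X₀ a b σ H : ℝ} {g : ℝ → ℝ} {ε : ℝ} {Y : ℝ → ℝ} (hε : 0 < ε)
    (h : Good X₀ a b σ H g ε Y) {s t : ℝ} (hs : 0 ≤ s) (ht : 0 ≤ t) :
    Y t - Y s = a * (∫ r in s..t, Fd H ε Y r) - b * (∫ r in s..t, Y r) + σ * (g t - g s) := by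
  have h1 := intervalIntegral.integral_interval_sub_left (ii_of (Fd_cont (H := H) hε h.cont) le_rfl ht)
    (ii_of (Fd_cont (H := H) hε h.cont) le_rfl hs)
  have h2 := intervalIntegral.integral_interval_sub_left (ii_of h.cont le_rfl ht)
    (ii_of h.cont le_rfl hs)
  rw [← h1, ← h2, h.eq t ht, h.eq s hs]
  ring

lemma hasDeriv_int {f : ℝ → ℝ} (hf : ContinuousOn f (Set.Ici 0)) {x : ℝ} (hx : 0 ≤ x) :
    HasDerivWithinAt (fun t => ∫ s in (0:ℝ)..t, f s) (f x) (Set.Ici x) x := by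
  have hc : ContinuousWithinAt f (Set.Ici x) x := (hf x hx).mono (Set.Ici_subset_Ici.mpr hx)
  refine intervalIntegral.integral_hasDerivWithinAt_right (t := Set.Ioi x) (ii_of hf le_rfl hx) ?_
    (hc.mono Set.Ioi_subset_Ici_self)
  exact ⟨Set.Ioi x, self_mem_nhdsWithin, (hf.mono (fun y hy => le_of_lt (lt_of_le_of_lt hx hy))).aestronglyMeasurable measurableSet_Ioi⟩

lemma good_anti {X₀ a b σ H : ℝ} {g : ℝ → ℝ} {ε₁ ε₂ : ℝ} {Y₁ Y₂ : ℝ → ℝ} (ha : 0 < a)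
    (hH : H < 1/2) (hε₁ : 0 < ε₁) (h12 : ε₁ < ε₂)
    (h₁ : Good X₀ a b σ H g ε₁ Y₁) (h₂ : Good X₀ a b σ H g ε₂ Y₂) {t : ℝ} (ht : 0 ≤ t) :
    Y₂ t ≤ Y₁ t := by
  have hε₂ : 0 < ε₂ := hε₁.trans h12
  have hF1 := Fd_cont (H := H) hε₁ h₁.cont
  have hF2 := Fd_cont (H := H) hε₂ h₂.cont
  have hD : ∀ x, 0 ≤ x → Y₂ x - Y₁ x = a * ((∫ s in (0:ℝ)..x, Fd H ε₂ Y₂ s) -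
      (∫ s in (0:ℝ)..x, Fd H ε₁ Y₁ s)) - b * ((∫ s in (0:ℝ)..x, Y₂ s) -
      (∫ s in (0:ℝ)..x, Y₁ s)) := by
    intro x hx
    rw [h₁.eq x hx, h₂.eq x hx]; ring
  have key := image_le_of_deriv_right_lt_deriv_boundary' (f := fun x => Y₂ x - Y₁ x)
    (f' := fun x => a * (Fd H ε₂ Y₂ x - Fd H ε₁ Y₁ x) - b * (Y₂ x - Y₁ x)) (a := 0) (b := t)
    (B := fun _ => 0) (B' := fun _ => 0) ?_ ?_ ?_ continuousOn_const
    (fun x _ => hasDerivWithinAt_const _ _ _) ?_ (x := t) ⟨ht, le_rfl⟩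
  · simpa using key
  · exact (h₂.cont.sub h₁.cont).mono Set.Icc_subset_Ici_self
  · intro x hx
    have hd := (((hasDeriv_int hF2 hx.1).sub (hasDeriv_int hF1 hx.1)).const_mul a).sub
      (((hasDeriv_int h₂.cont hx.1).sub (hasDeriv_int h₁.cont hx.1)).const_mul b)
    refine hd.congr ?_ ?_
    · intro y hy
      exact hD y (hx.1.trans hy)
    · exact hD x hx.1
  · simpa using (hD 0 le_rfl).le
  · intro x hx hxe
    have hxe' : Y₂ x = Y₁ x := by simpa [sub_eq_zero] using hxe
    have hx0 : 0 ≤ x := hx.1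
    have hlt : Fd H ε₂ Y₂ x < Fd H ε₁ Y₁ x := by
      unfold Fd
      rw [hxe', den_eq]
      have := le_max_right (Y₁ x) 0
      apply div_lt_div₀
      · exact Real.rpow_lt_rpow_of_neg (by positivity) (by linarith) (by linarith)
      · linarith
      · positivity
      · positivity
    simp only [hxe', sub_self, mul_zero, sub_zero]
    exact mul_neg_of_pos_of_neg ha (by linarith)

lemma last_exit {f : ℝ → ℝ} {s t c : ℝ} (hst : s ≤ t) (hf : ContinuousOn f (Set.Icc s t))
    (hs : f s ≤ c) : ∃ τ ∈ Set.Icc s t, f τ ≤ c ∧ ∀ r ∈ Set.Ioc τ t, c < f r := by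
  have hcl : IsClosed (Set.Icc s t ∩ f ⁻¹' Set.Iic c) := hf.preimage_isClosed_of_isClosed isClosed_Icc isClosed_Iic
  have hco : IsCompact (Set.Icc s t ∩ f ⁻¹' Set.Iic c) :=
    isCompact_Icc.of_isClosed_subset hcl Set.inter_subset_left
  obtain ⟨τ, hτ, hmax⟩ := hco.exists_isGreatest ⟨s, ⟨le_rfl, hst⟩, hs⟩
  refine ⟨τ, hτ.1, hτ.2, fun r hr => ?_⟩
  by_contra hcon
  have := hmax ⟨⟨hτ.1.1.trans hr.1.le, hr.2⟩, not_lt.mp hcon⟩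
  exact absurd hr.1 (not_lt.mpr this)

/-- Upper bound after a low value. -/
lemma lemA {X₀ a b σ H : ℝ} {g : ℝ → ℝ} {ε : ℝ} {Y : ℝ → ℝ} (ha : 0 < a) (hb : 0 ≤ b)
    (hσ : 0 < σ) (hH : H < 1/2) (hε : 0 < ε) (h : Good X₀ a b σ H g ε Y)
    {C β T : ℝ} (hC : 0 < C) (hβ : 0 < β)
    (hg : ∀ s ∈ Set.Icc (0:ℝ) T, ∀ t ∈ Set.Icc (0:ℝ) T, |g t - g s| ≤ C * |t - s| ^ β)
    {α η t : ℝ} (hα : 0 < α) (hη : 0 < η) (hαt : α ≤ t) (htT : t ≤ T) (hY : Y α ≤ η) :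
    Y t ≤ η + a * (α ^ (2*H-1) / η) * (t - α) + σ * (C * (t - α) ^ β) := by
  obtain ⟨τ, ⟨hτ1, hτ2⟩, hτY, hτ⟩ := last_exit hαt
    (h.cont.mono (fun x hx => hα.le.trans hx.1)) hY
  have hτ0 : 0 ≤ τ := by linarith
  have ht0 : 0 ≤ t := by linarith
  have hinc := h.incr hε hτ0 ht0
  have h1 : (∫ r in τ..t, Fd H ε Y r) ≤ α ^ (2*H-1) / η * (t - τ) := by
    have : ‖∫ r in τ..t, Fd H ε Y r‖ ≤ α ^ (2*H-1) / η * |t - τ| := by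
      apply intervalIntegral.norm_integral_le_of_norm_le_const
      intro r hr
      rw [Set.uIoc_of_le hτ2] at hr
      have hYr := hτ r hr
      have hr0 : α < r := lt_of_le_of_lt hτ1 hr.1
      rw [Real.norm_of_nonneg (Fd_nonneg hε (by linarith))]
      unfold Fd
      rw [if_pos (hη.trans hYr)]
      apply div_le_div₀
      · positivity
      · exact Real.rpow_le_rpow_of_nonpos hα (by linarith) (by linarith)
      · exact hη
      · linarith
    rw [abs_of_nonneg (by linarith)] at this
    exact (le_abs_self _).trans this
  have h2 : 0 ≤ ∫ r in τ..t, Y r := by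
    rw [intervalIntegral.integral_of_le hτ2]
    exact setIntegral_nonneg measurableSet_Ioc (fun r hr => (hη.trans (hτ r hr)).le)
  have h3 : g t - g τ ≤ C * (t - α) ^ β := by
    refine (le_abs_self _).trans ((hg τ ⟨hτ0, by linarith⟩ t ⟨ht0, htT⟩).trans ?_)
    rw [abs_of_nonneg (by linarith)]
    gcongr
  have h4 : α ^ (2*H-1) / η * (t - τ) ≤ α ^ (2*H-1) / η * (t - α) := by
    gcongr
  have h5 := mul_le_mul_of_nonneg_left (h1.trans h4) ha.le
  have h6 := mul_le_mul_of_nonneg_left h3 hσ.le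
  have h7 := mul_nonneg hb h2
  nlinarith

lemma limit_nonneg {X₀ a b σ H : ℝ} {g : ℝ → ℝ} (hX₀ : 0 < X₀) (ha : 0 < a) (hb : 0 ≤ b)
    (hσ : 0 < σ) (hH : H < 1/2) (hg0 : g 0 = 0) (Xe : ℝ → ℝ → ℝ)
    (h : ∀ ε > 0, Good X₀ a b σ H g ε (Xe ε))
    {C β t x : ℝ} (hC : 0 < C) (hβ : 0 < β)
    (hg : ∀ r ∈ Set.Icc (0:ℝ) t, ∀ s ∈ Set.Icc (0:ℝ) t, |g s - g r| ≤ C * |s - r| ^ β)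
    (ht : 0 < t)
    (hx : Tendsto (fun ε => Xe ε t) (nhdsWithin 0 (Set.Ioi 0)) (nhds x)) : 0 ≤ x := by
  refine le_of_forall_pos_le_add (fun δ hδ => ?_)
  have hlim : Tendsto (fun d : ℝ => σ * (C * d ^ β)) (nhdsWithin 0 (Set.Ioi 0)) (nhds 0) := by
    have : ContinuousAt (fun d : ℝ => σ * (C * d ^ β)) 0 :=
      ((Real.continuousAt_rpow_const 0 β (Or.inr hβ.le)).const_mul C).const_mul σ
    have h0 := this.tendsto.mono_left (nhdsWithin_le_nhds (s := Set.Ioi 0))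
    simpa [Real.zero_rpow hβ.ne'] using h0
  obtain ⟨d0, hd0, hd0pos⟩ := ((hlim.eventually (ge_mem_nhds hδ)).and self_mem_nhdsWithin).exists
  have hd0pos : 0 < d0 := hd0pos
  set K := a * (t+1) ^ (2*H-1) with hK
  have hKpos : 0 < K := by positivity
  have hS : 0 < σ * (C * t ^ β) := by positivity
  have hthr : 0 < K * d0 / (σ * (C * t ^ β)) := by positivity
  suffices hs : -δ ≤ x by linarith
  refine ge_of_tendsto hx ?_
  have e1 : ∀ᶠ ε : ℝ in nhdsWithin 0 (Set.Ioi 0), ε < K * d0 / (σ * (C * t ^ β)) :=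
    mem_nhdsWithin_of_mem_nhds (Iio_mem_nhds hthr)
  have e2 : ∀ᶠ ε : ℝ in nhdsWithin 0 (Set.Ioi 0), ε < 1 :=
    mem_nhdsWithin_of_mem_nhds (Iio_mem_nhds one_pos)
  filter_upwards [e1, e2, self_mem_nhdsWithin] with ε he1 he2 hε
  have hε : 0 < ε := hε
  have hG := h ε hε
  have hY0 : Xe ε 0 = X₀ := by rw [hG.eq 0 le_rfl]; simp [hg0]
  obtain ⟨τ, ⟨hτ1, hτ2⟩, hτY, hτ⟩ := last_exit (f := fun r => - Xe ε r) (c := 0) ht.le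
    (hG.cont.neg.mono Set.Icc_subset_Ici_self) (by simp [hY0, hX₀.le])
  have hinc := hG.incr hε hτ1 ht.le
  have h1 : (t+1) ^ (2*H-1) / ε * (t - τ) ≤ ∫ r in τ..t, Fd H ε (Xe ε) r := by
    have : ∫ r in τ..t, ((t+1) ^ (2*H-1) / ε) ≤ ∫ r in τ..t, Fd H ε (Xe ε) r := by
      apply intervalIntegral.integral_mono_on_of_le_Ioo hτ2 (by simp)
        (ii_of (Fd_cont hε hG.cont) hτ1 ht.le)
      intro r hr
      have hYr := hτ r ⟨hr.1, hr.2.le⟩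
      unfold Fd
      rw [if_neg (by linarith), zero_add]
      have := Real.rpow_le_rpow_of_nonpos (x := r + ε) (y := t + 1) (z := 2*H-1)
        (by linarith [hr.1]) (by linarith [hr.2]) (by linarith)
      gcongr
    rw [intervalIntegral.integral_const, smul_eq_mul] at this
    linarith
  have h2 : (∫ r in τ..t, Xe ε r) ≤ 0 := by
    rw [intervalIntegral.integral_of_le hτ2]
    exact setIntegral_nonpos measurableSet_Ioc (fun r hr => by linarith [hτ r hr])
  have h3 : -(C * (t - τ) ^ β) ≤ g t - g τ := by
    have := hg τ ⟨hτ1, hτ2⟩ t ⟨ht.le, le_rfl⟩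
    rw [abs_of_nonneg (by linarith : 0 ≤ t - τ)] at this
    linarith [neg_abs_le (g t - g τ)]
  have h5 := mul_le_mul_of_nonneg_left h1 ha.le
  have h6 := mul_le_mul_of_nonneg_left h3 hσ.le
  have h7 := mul_nonneg hb (neg_nonneg.mpr h2)
  have h8 : K / ε * (t - τ) - σ * (C * (t - τ) ^ β) ≤ Xe ε t := by
    have : K / ε * (t - τ) = a * ((t+1) ^ (2*H-1) / ε * (t - τ)) := by rw [hK]; ring
    nlinarith
  rcases le_or_gt (t - τ) d0 with hd | hd
  · have : σ * (C * (t - τ) ^ β) ≤ σ * (C * d0 ^ β) := by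
      have : 0 ≤ t - τ := by linarith
      gcongr
    have : 0 ≤ K / ε * (t - τ) := mul_nonneg (by positivity) (by linarith)
    linarith
  · have i1 : σ * (C * (t - τ) ^ β) ≤ σ * (C * t ^ β) := by
      have : 0 ≤ t - τ := by linarith
      gcongr
      linarith
    have i2 : σ * (C * t ^ β) ≤ K / ε * d0 := by
      rw [lt_div_iff₀ hS] at he1
      rw [div_mul_eq_mul_div, le_div_iff₀ hε]
      linarith
    have i3 : K / ε * d0 ≤ K / ε * (t - τ) := by gcongr
    linarith

lemma dct {F : ℝ → ℝ → ℝ} {f : ℝ → ℝ} {u v K : ℝ} (huv : u ≤ v)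
    (hFc : ∀ ε > 0, ContinuousOn (F ε) (Set.Icc u v))
    (hb : ∀ᶠ ε in nhdsWithin (0:ℝ) (Set.Ioi 0), ∀ s ∈ Set.Icc u v, |F ε s| ≤ K)
    (hl : ∀ s ∈ Set.Icc u v,
      Tendsto (fun ε => F ε s) (nhdsWithin (0:ℝ) (Set.Ioi 0)) (nhds (f s))) :
    IntervalIntegrable f volume u v ∧
      Tendsto (fun ε => ∫ s in u..v, F ε s) (nhdsWithin (0:ℝ) (Set.Ioi 0))
        (nhds (∫ s in u..v, f s)) := by
  have hm : ∀ ε > 0, AEStronglyMeasurable (F ε) (volume.restrict (Set.Ioc u v)) := fun ε hε =>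
    ((hFc ε hε).mono Set.Ioc_subset_Icc_self).aestronglyMeasurable measurableSet_Ioc
  have hseq : Tendsto (fun n : ℕ => 1 / ((n:ℝ) + 1)) atTop (nhdsWithin (0:ℝ) (Set.Ioi 0)) := by
    refine tendsto_nhdsWithin_iff.mpr ⟨tendsto_one_div_add_atTop_nhds_zero_nat, ?_⟩
    exact Eventually.of_forall (fun n => by simp only [Set.mem_Ioi]; positivity)
  have hfm : AEStronglyMeasurable f (volume.restrict (Set.Ioc u v)) := by
    refine aestronglyMeasurable_of_tendsto_ae atTop
      (f := fun n : ℕ => F (1 / ((n:ℝ) + 1))) (fun n => hm _ (by positivity)) ?_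
    refine (ae_restrict_iff' measurableSet_Ioc).mpr (Eventually.of_forall (fun s hs => ?_))
    exact (hl s (Set.Ioc_subset_Icc_self hs)).comp hseq
  refine ⟨?_, ?_⟩
  · rw [intervalIntegrable_iff_integrableOn_Ioc_of_le huv]
    refine Integrable.of_bound hfm K ?_
    refine (ae_restrict_iff' measurableSet_Ioc).mpr (Eventually.of_forall (fun s hs => ?_))
    refine le_of_tendsto (hl s (Set.Ioc_subset_Icc_self hs)).norm ?_
    filter_upwards [hb] with ε hε
    exact hε s (Set.Ioc_subset_Icc_self hs)
  · refine intervalIntegral.tendsto_integral_filter_of_dominated_convergence (fun _ => K) ?_ ?_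
      (by simp) ?_
    · filter_upwards [self_mem_nhdsWithin] with ε hε
      rw [Set.uIoc_of_le huv]
      exact hm ε hε
    · filter_upwards [hb] with ε hε
      refine Eventually.of_forall (fun s hs => ?_)
      rw [Set.uIoc_of_le huv] at hs
      exact hε s (Set.Ioc_subset_Icc_self hs)
    · refine Eventually.of_forall (fun s hs => ?_)
      rw [Set.uIoc_of_le huv] at hs
      exact hl s (Set.Ioc_subset_Icc_self hs)

lemma comp_lower {Xe : ℝ → ℝ → ℝ} {X : ℝ → ℝ}
    (hc : ∀ ε > 0, ContinuousOn (Xe ε) (Set.Ici 0))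
    (hanti : ∀ ε₁ > 0, ∀ ε₂ > ε₁, ∀ t ≥ 0, Xe ε₂ t ≤ Xe ε₁ t)
    (hX : ∀ t ≥ (0:ℝ),
      Tendsto (fun ε => Xe ε t) (nhdsWithin 0 (Set.Ioi 0)) (nhds (X t)))
    {u v : ℝ} (hu : 0 ≤ u) (hpos : ∀ s ∈ Set.Icc u v, 0 < X s) :
    ∃ m > 0, ∃ ε₀ > 0, ∀ ε, 0 < ε → ε < ε₀ → ∀ s ∈ Set.Icc u v, m ≤ Xe ε s := by
  refine isCompact_Icc.induction_on (p := fun S => ∃ m > 0, ∃ ε₀ > 0, ∀ ε, 0 < ε → ε < ε₀ →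
    ∀ s ∈ S, m ≤ Xe ε s) ⟨1, one_pos, 1, one_pos, by simp⟩ ?_ ?_ ?_
  · rintro S T hST ⟨m, hm, e, he, h⟩
    exact ⟨m, hm, e, he, fun ε h1 h2 s hs => h ε h1 h2 s (hST hs)⟩
  · rintro S T ⟨m, hm, e, he, h⟩ ⟨m', hm', e', he', h'⟩
    refine ⟨min m m', lt_min hm hm', min e e', lt_min he he', fun ε h1 h2 s hs => ?_⟩
    rcases hs with hs | hs
    · exact (min_le_left _ _).trans (h ε h1 (h2.trans_le (min_le_left _ _)) s hs)
    · exact (min_le_right _ _).trans (h' ε h1 (h2.trans_le (min_le_right _ _)) s hs)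
  · intro s hs
    have hs0 : 0 ≤ s := hu.trans hs.1
    have hXs := hpos s hs
    obtain ⟨e, he, hepos⟩ := (((hX s hs0).eventually (lt_mem_nhds (half_lt_self hXs))).and
      self_mem_nhdsWithin).exists
    have hepos : 0 < e := hepos
    have hcw : ContinuousWithinAt (Xe e) (Set.Icc u v) s :=
      (hc e hepos s hs0).mono (fun y hy => hu.trans hy.1)
    refine ⟨{y | X s / 2 < Xe e y} ∩ Set.Icc u v,
      inter_mem (hcw.eventually (lt_mem_nhds he)) self_mem_nhdsWithin,
      X s / 2, half_pos hXs, e, hepos, fun ε h1 h2 y hy => ?_⟩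
    exact hy.1.le.trans (hanti ε h1 e h2 y (hu.trans hy.2.1))

lemma interior_eq {X₀ a b σ H : ℝ} {g : ℝ → ℝ} (hH : H < 1/2)
    {Xe : ℝ → ℝ → ℝ} {X : ℝ → ℝ} (h : ∀ ε > 0, Good X₀ a b σ H g ε (Xe ε))
    (hanti : ∀ ε₁ > 0, ∀ ε₂ > ε₁, ∀ t ≥ 0, Xe ε₂ t ≤ Xe ε₁ t)
    (hX : ∀ t ≥ (0:ℝ),
      Tendsto (fun ε => Xe ε t) (nhdsWithin 0 (Set.Ioi 0)) (nhds (X t)))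
    {u v M : ℝ} (hu : 0 < u) (huv : u ≤ v) (hpos : ∀ s ∈ Set.Icc u v, 0 < X s)
    (hM : ∀ᶠ ε in nhdsWithin (0:ℝ) (Set.Ioi 0), ∀ s ∈ Set.Icc u v, |Xe ε s| ≤ M) :
    IntervalIntegrable (fun s => s ^ (2*H-1) / X s) volume u v ∧
    X v - X u = a * (∫ s in u..v, s ^ (2 * H - 1) / X s)
        - b * (∫ s in u..v, X s) + σ * (g v - g u) := by
  have hsub : Set.Icc u v ⊆ Set.Ici 0 := fun y hy => hu.le.trans hy.1
  obtain ⟨m, hm, e0, he0, hlow⟩ := comp_lower (fun ε hε => (h ε hε).cont) hanti hX hu.le hpos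
  have hev : ∀ᶠ ε : ℝ in nhdsWithin 0 (Set.Ioi 0), ε < e0 :=
    mem_nhdsWithin_of_mem_nhds (Iio_mem_nhds he0)
  obtain ⟨hi, hlim1⟩ := dct (F := fun ε => Fd H ε (Xe ε)) (f := fun s => s ^ (2*H-1) / X s)
    (K := u ^ (2*H-1) / m) huv
    (fun ε hε => (Fd_cont hε (h ε hε).cont).mono hsub) (by
      filter_upwards [hev, self_mem_nhdsWithin] with ε h1 h2 s hs
      have h2 : 0 < ε := h2
      have hY := hlow ε h2 h1 s hs
      rw [abs_of_nonneg (Fd_nonneg h2 (hsub hs))]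
      unfold Fd
      rw [if_pos (hm.trans_le hY)]
      apply div_le_div₀
      · positivity
      · exact Real.rpow_le_rpow_of_nonpos hu (by linarith [hs.1]) (by linarith)
      · exact hm
      · linarith) (by
      intro s hs
      have hs0 : 0 < s := hu.trans_le hs.1
      have hid : Tendsto (fun ε : ℝ => ε) (nhdsWithin 0 (Set.Ioi 0)) (nhds 0) :=
        tendsto_id.mono_left nhdsWithin_le_nhds
      have t1 : Tendsto (fun ε : ℝ => (s + ε) ^ (2*H-1)) (nhdsWithin 0 (Set.Ioi 0))
          (nhds (s ^ (2*H-1))) := by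
        have := (tendsto_const_nhds (x := s)).add hid
        rw [add_zero] at this
        exact this.rpow_const (Or.inl hs0.ne')
      have t2 : Tendsto (fun ε : ℝ => max (Xe ε s) 0 + ε) (nhdsWithin 0 (Set.Ioi 0))
          (nhds (X s)) := by
        have := ((hX s hs0.le).max (tendsto_const_nhds (x := (0:ℝ)))).add hid
        rwa [add_zero, max_eq_left (hpos s hs).le] at this
      simp only [Fd, den_eq]
      exact t1.div t2 (hpos s hs).ne')
  obtain ⟨-, hlim2⟩ := dct (F := Xe) (f := X) (K := M) huv
    (fun ε hε => (h ε hε).cont.mono hsub) hM (fun s hs => hX s (hsub hs))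
  refine ⟨hi, ?_⟩
  have hL := (hX v (hu.le.trans huv)).sub (hX u hu.le)
  have hR := ((hlim1.const_mul a).sub (hlim2.const_mul b)).add
    (tendsto_const_nhds (x := σ * (g v - g u)))
  refine tendsto_nhds_unique hL (hR.congr' ?_)
  filter_upwards [self_mem_nhdsWithin] with ε hε
  exact ((h ε hε).incr hε hu.le (hu.le.trans huv)).symm

/-- **Theorem 3.9(b).** Let `(α, β')` be a connected component of
`{t > 0 : X_t > 0}` with `α > 0` and `β' < ∞`.  Then for every `t ∈ [α, β']`,
`X_t = a ∫_α^t s^{2H-1}/X_s ds − b ∫_α^t X_s ds + σ (g(t) − g(α))`. -/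
theorem excursion_equation
    (X₀ a b σ H : ℝ) (hX₀ : 0 < X₀) (ha : 0 < a) (hb : 0 ≤ b) (hσ : 0 < σ)
    (hH0 : 0 < H) (hH : H < 1/2)
    (g : ℝ → ℝ) (hgc : ContinuousOn g (Set.Ici 0)) (hg0 : g 0 = 0)
    (Xe : ℝ → ℝ → ℝ)
    (hXe : ∀ ε > (0:ℝ), ∀ T > (0:ℝ), approxSol X₀ a b σ H g T ε (Xe ε))
    (X : ℝ → ℝ)
    (hX : ∀ t ≥ (0:ℝ),
      Tendsto (fun ε => Xe ε t) (nhdsWithin 0 (Set.Ioi 0)) (nhds (X t)))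
    (β : ℝ) (hβ0 : 0 < β) (hβH : β < H)
    (hgH : ∀ T > (0:ℝ), ∃ C > (0:ℝ), ∀ s ∈ Set.Icc (0:ℝ) T, ∀ t ∈ Set.Icc (0:ℝ) T,
      |g t - g s| ≤ C * |t - s| ^ β)
    (α β' : ℝ) (hα : 0 < α) (hαβ : α < β')
    (hcomp : ∀ t ∈ Set.Ioo α β', 0 < X t)
    (hXα : X α ≤ 0) (hXβ : X β' ≤ 0) :
    ∀ t ∈ Set.Icc α β',
      X t = a * (∫ s in α..t, s ^ (2 * H - 1) / X s)
        - b * (∫ s in α..t, X s) + σ * (g t - g α) := by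
  have h : ∀ ε > 0, Good X₀ a b σ H g ε (Xe ε) := fun ε hε => good_of (hXe ε hε)
  have hanti : ∀ ε₁ > 0, ∀ ε₂ > ε₁, ∀ t ≥ 0, Xe ε₂ t ≤ Xe ε₁ t := fun e1 he1 e2 he2 t ht =>
    good_anti ha hH he1 he2 (h e1 he1) (h e2 (lt_trans he1 he2)) ht
  have hβend0 : 0 < β' := hα.trans hαβ
  have hsub : Set.Icc α β' ⊆ Set.Ici 0 := fun y hy => hα.le.trans hy.1
  have hleX : ∀ ε > 0, ∀ t ≥ 0, Xe ε t ≤ X t := by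
    intro ε hε t ht
    refine ge_of_tendsto (hX t ht) ?_
    have hev : ∀ᶠ e : ℝ in nhdsWithin 0 (Set.Ioi 0), e < ε :=
      mem_nhdsWithin_of_mem_nhds (Iio_mem_nhds hε)
    filter_upwards [hev, self_mem_nhdsWithin] with e h1 h2
    exact hanti e h2 ε h1 t ht
  obtain ⟨C, hC, hg⟩ := hgH β' hβend0
  -- values at the end points
  have hnn : ∀ t, 0 < t → t ≤ β' → 0 ≤ X t := fun t ht htb =>
    limit_nonneg hX₀ ha hb hσ hH hg0 Xe h hC hβ0
      (fun r hr s hs => hg r ⟨hr.1, hr.2.trans htb⟩ s ⟨hs.1, hs.2.trans htb⟩) ht (hX t ht.le)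
  have hα0 : X α = 0 := le_antisymm hXα (hnn α hα hαβ.le)
  have hβendX : X β' = 0 := le_antisymm hXβ (hnn β' hβend0 le_rfl)
  have hup : ∀ ε > 0, ∀ η > 0, ∀ t ∈ Set.Icc α β', Xe ε t ≤
      η + a * (α ^ (2*H-1) / η) * (t - α) + σ * (C * (t - α) ^ β) := by
    intro ε hε η hη t ht
    exact lemA ha hb hσ hH hε (h ε hε) hC hβ0 hg hα hη ht.1 ht.2
      (((hleX ε hε α hα.le).trans hXα).trans hη.le)
  -- uniform bound
  obtain ⟨M, hM0, hM⟩ : ∃ M ≥ 0, ∀ᶠ ε in nhdsWithin (0:ℝ) (Set.Ioi 0),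
      ∀ s ∈ Set.Icc α β', |Xe ε s| ≤ M := by
    obtain ⟨N, hN⟩ := isCompact_Icc.exists_bound_of_continuousOn ((h 1 one_pos).cont.mono hsub)
    refine ⟨max N (1 + a * (α ^ (2*H-1) / 1) * (β' - α) + σ * (C * (β' - α) ^ β)), ?_, ?_⟩
    · exact le_max_of_le_left ((norm_nonneg _).trans (hN α ⟨le_rfl, hαβ.le⟩))
    · have hev : ∀ᶠ e : ℝ in nhdsWithin 0 (Set.Ioi 0), e < 1 :=
        mem_nhdsWithin_of_mem_nhds (Iio_mem_nhds one_pos)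
      filter_upwards [hev, self_mem_nhdsWithin] with e h1 h2 s hs
      refine abs_le.mpr ⟨?_, ?_⟩
      · have i1 := hanti e h2 1 h1 s (hsub hs)
        have i2 := (abs_le.mp (hN s hs)).1
        have i3 := le_max_left N (1 + a * (α ^ (2*H-1) / 1) * (β' - α) + σ * (C * (β' - α) ^ β))
        linarith
      · refine le_max_of_le_right ((hup e h2 1 one_pos s hs).trans ?_)
        have : 0 ≤ s - α := by linarith [hs.1]
        have := hs.2
        gcongr
  have hXM : ∀ s ∈ Set.Icc α β', |X s| ≤ M := by
    intro s hs
    refine le_of_tendsto (hX s (hsub hs)).abs ?_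
    filter_upwards [hM] with ε hε using hε s hs
  obtain ⟨hXi, -⟩ := dct (F := Xe) (f := X) (K := M) hαβ.le
    (fun ε hε => (h ε hε).cont.mono hsub) hM (fun s hs => hX s (hsub hs))
  have hinterior : ∀ u ∈ Set.Ioo α β', ∀ v ∈ Set.Ioo α β', u ≤ v →
      IntervalIntegrable (fun s => s ^ (2*H-1) / X s) volume u v ∧
      X v - X u = a * (∫ s in u..v, s ^ (2 * H - 1) / X s)
        - b * (∫ s in u..v, X s) + σ * (g v - g u) := by
    intro u hu v hv huv
    refine interior_eq (M := M) hH h hanti hX (hα.trans hu.1) huv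
      (fun s hs => hcomp s ⟨hu.1.trans_le hs.1, hs.2.trans_lt hv.2⟩) ?_
    filter_upwards [hM] with ε hε s hs
    exact hε s ⟨hu.1.le.trans hs.1, hs.2.trans hv.2.le⟩
  -- bound for integrals of X
  have hXint : ∀ u ∈ Set.Icc α β', ∀ v ∈ Set.Icc α β', u ≤ v →
      |∫ s in u..v, X s| ≤ M * (v - u) := by
    intro u hu v hv huv
    have := intervalIntegral.norm_integral_le_of_norm_le_const (f := X) (a := u) (b := v) (C := M)
      (fun s hs => by
        rw [Set.uIoc_of_le huv] at hs
        exact hXM s ⟨hu.1.trans hs.1.le, hs.2.trans hv.2⟩)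
    rwa [abs_of_nonneg (sub_nonneg.mpr huv)] at this
  have hgb : ∀ u ∈ Set.Icc α β', ∀ v ∈ Set.Icc α β', u ≤ v →
      |g v - g u| ≤ C * (v - u) ^ β := by
    intro u hu v hv huv
    have := hg u ⟨hsub hu, hu.2⟩ v ⟨hsub hv, hv.2⟩
    rwa [abs_of_nonneg (sub_nonneg.mpr huv)] at this
  -- integrability
  have hfint : IntegrableOn (fun s => s ^ (2*H-1) / X s) (Set.Ioc α β') := by
    have hmem : ∀ n : ℕ, α + (β' - α) * ((1/2) * (1 / ((n:ℝ) + 1))) ∈ Set.Ioo α β' ∧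
        β' - (β' - α) * ((1/2) * (1 / ((n:ℝ) + 1))) ∈ Set.Ioo α β' ∧
        α + (β' - α) * ((1/2) * (1 / ((n:ℝ) + 1))) ≤
          β' - (β' - α) * ((1/2) * (1 / ((n:ℝ) + 1))) := by
      intro n
      have h1 : 0 < 1 / ((n:ℝ) + 1) := by positivity
      have h2 : 1 / ((n:ℝ) + 1) ≤ 1 := by
        rw [div_le_one (by positivity)]
        have : (0:ℝ) ≤ n := by positivity
        linarith
      have h3 : 0 < β' - α := by linarith
      refine ⟨⟨?_, ?_⟩, ⟨?_, ?_⟩, ?_⟩ <;> nlinarith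
    have hz : Tendsto (fun n : ℕ => (β' - α) * ((1/2) * (1 / ((n:ℝ) + 1)))) atTop (nhds 0) := by
      have := ((tendsto_one_div_add_atTop_nhds_zero_nat (𝕜 := ℝ)).const_mul (1/2)).const_mul
        (β' - α)
      rwa [mul_zero, mul_zero] at this
    refine integrableOn_Ioc_of_intervalIntegral_norm_bounded (l := atTop)
      (I := (2 * M + b * (M * (β' - α)) + σ * (C * (β' - α) ^ β)) / a)
      (a := fun n : ℕ => α + (β' - α) * ((1/2) * (1 / ((n:ℝ) + 1))))
      (b := fun n : ℕ => β' - (β' - α) * ((1/2) * (1 / ((n:ℝ) + 1)))) ?_ ?_ ?_ ?_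
    · intro n
      obtain ⟨h1, h2, h3⟩ := hmem n
      exact (intervalIntegrable_iff_integrableOn_Ioc_of_le h3).mp (hinterior _ h1 _ h2 h3).1
    · simpa using hz.const_add α
    · simpa using hz.const_sub β'
    · refine Eventually.of_forall (fun n => ?_)
      obtain ⟨h1, h2, h3⟩ := hmem n
      generalize α + (β' - α) * ((1/2) * (1 / ((n:ℝ) + 1))) = u at h1 h2 h3 ⊢
      generalize β' - (β' - α) * ((1/2) * (1 / ((n:ℝ) + 1))) = v at h1 h2 h3 ⊢
      have hu' := Set.Ioo_subset_Icc_self h1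
      have hv' := Set.Ioo_subset_Icc_self h2
      have he := (hinterior u h1 v h2 h3).2
      have hn : ∫ x in Set.Ioc u v, ‖x ^ (2*H-1) / X x‖ = ∫ x in u..v, x ^ (2*H-1) / X x := by
        rw [intervalIntegral.integral_of_le h3]
        refine setIntegral_congr_fun measurableSet_Ioc (fun x hx => ?_)
        have hx1 : α < x := h1.1.trans hx.1
        have := hcomp x ⟨hx1, hx.2.trans_lt h2.2⟩
        have hx0 : 0 < x := hα.trans hx1
        exact Real.norm_of_nonneg (by positivity)
      rw [hn, le_div_iff₀ ha]
      have j1 := abs_le.mp (hXM u hu')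
      have j2 := abs_le.mp (hXM v hv')
      have j3 := (abs_le.mp (hXint u hu' v hv' h3)).2
      have j4 := (abs_le.mp (hgb u hu' v hv' h3)).1
      have j5 : M * (v - u) ≤ M * (β' - α) := by
        gcongr
        · exact h2.2.le
        · exact h1.1.le
      have j6 : C * (v - u) ^ β ≤ C * (β' - α) ^ β := by
        have : 0 ≤ v - u := by linarith
        gcongr
        · exact h2.2.le
        · exact h1.1.le
      have j7 := mul_le_mul_of_nonneg_left (j3.trans j5) hb
      have j8 := mul_le_mul_of_nonneg_left (show -(C * (β' - α) ^ β) ≤ g v - g u by linarith) hσ.le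
      linarith
  -- limits at the end points
  have hpow : Continuous (fun x : ℝ => x ^ β) := Real.continuous_rpow_const hβ0.le
  have limα : Tendsto X (nhdsWithin α (Set.Ioo α β')) (nhds 0) := by
    refine tendsto_order.mpr ⟨fun c hc => ?_, fun c hc => ?_⟩
    · filter_upwards [self_mem_nhdsWithin] with s hs using hc.trans (hcomp s hs)
    · have hcont : Continuous (fun t : ℝ => c/2 + a * (α ^ (2*H-1) / (c/2)) * (t - α) +
          σ * (C * (t - α) ^ β)) := by
        have := hpow.comp (continuous_id.sub (continuous_const (y := α)))
        have h2 : Continuous (fun t : ℝ => (t - α) ^ β) := this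
        fun_prop
      have hval := hcont.tendsto α
      simp only [sub_self, mul_zero, add_zero, Real.zero_rpow hβ0.ne'] at hval
      have hev := (hval.mono_left (nhdsWithin_le_nhds (s := Set.Ioo α β'))).eventually
        (gt_mem_nhds (half_lt_self hc))
      filter_upwards [hev, self_mem_nhdsWithin] with t h1 ht
      refine lt_of_le_of_lt ?_ h1
      refine le_of_tendsto (hX t (hα.le.trans ht.1.le)) ?_
      filter_upwards [self_mem_nhdsWithin] with ε hε
      exact hup ε hε (c/2) (half_pos hc) t (Set.Ioo_subset_Icc_self ht)
  have limβ : Tendsto X (nhdsWithin β' (Set.Ioo α β')) (nhds 0) := by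
    have hcont : Continuous (fun t : ℝ => b * (M * (β' - t)) + σ * (C * (β' - t) ^ β)) := by
      have := hpow.comp ((continuous_const (y := β')).sub continuous_id)
      have h2 : Continuous (fun t : ℝ => (β' - t) ^ β) := this
      fun_prop
    have hval := hcont.tendsto β'
    simp only [sub_self, mul_zero, add_zero, Real.zero_rpow hβ0.ne'] at hval
    refine tendsto_of_tendsto_of_tendsto_of_le_of_le' tendsto_const_nhds
      (hval.mono_left (nhdsWithin_le_nhds (s := Set.Ioo α β'))) ?_ ?_
    · filter_upwards [self_mem_nhdsWithin] with s hs using (hcomp s hs).le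
    · filter_upwards [self_mem_nhdsWithin] with t ht
      have ht0 : 0 ≤ t := hα.le.trans ht.1.le
      have hl := (hX t ht0).sub (hX β' hβend0.le)
      rw [hβendX, sub_zero] at hl
      refine le_of_tendsto hl ?_
      filter_upwards [self_mem_nhdsWithin, hM] with ε hε hMε
      have hinc := (h ε hε).incr hε ht0 hβend0.le
      have k1 : 0 ≤ ∫ r in t..β', Fd H ε (Xe ε) r :=
        intervalIntegral.integral_nonneg ht.2.le (fun r hr => Fd_nonneg hε (ht0.trans hr.1))
      have k2 : (∫ r in t..β', Xe ε r) ≤ M * (β' - t) := by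
        have := intervalIntegral.norm_integral_le_of_norm_le_const (f := Xe ε) (a := t) (b := β')
          (C := M) (fun s hs => by
            rw [Set.uIoc_of_le ht.2.le] at hs
            exact hMε s ⟨ht.1.le.trans hs.1.le, hs.2⟩)
        rw [abs_of_nonneg (sub_nonneg.mpr ht.2.le)] at this
        exact (le_abs_self _).trans this
      have k3 := (abs_le.mp (hgb t (Set.Ioo_subset_Icc_self ht) β' ⟨hαβ.le, le_rfl⟩ ht.2.le)).1
      have k4 := mul_le_mul_of_nonneg_left k2 hb
      have k5 := mul_le_mul_of_nonneg_left k3 hσ.le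
      have k6 := mul_nonneg ha.le k1
      linarith
  -- conclusion
  set Φ : ℝ → ℝ := fun t => a * (∫ s in α..t, s ^ (2 * H - 1) / X s)
        - b * (∫ s in α..t, X s) + σ * (g t - g α) with hΦ
  have hfi : IntervalIntegrable (fun s => s ^ (2*H-1) / X s) volume α β' :=
    (intervalIntegrable_iff_integrableOn_Ioc_of_le hαβ.le).mpr hfint
  have hΦc : ContinuousOn Φ (Set.Icc α β') := by
    have c1 : ContinuousOn (fun t => ∫ s in α..t, s ^ (2 * H - 1) / X s) (Set.Icc α β') := by
      have := intervalIntegral.continuousOn_primitive_interval' hfi Set.left_mem_uIcc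
      rwa [Set.uIcc_of_le hαβ.le] at this
    have c2 : ContinuousOn (fun t => ∫ s in α..t, X s) (Set.Icc α β') := by
      have := intervalIntegral.continuousOn_primitive_interval' hXi Set.left_mem_uIcc
      rwa [Set.uIcc_of_le hαβ.le] at this
    have c3 : ContinuousOn g (Set.Icc α β') := hgc.mono hsub
    exact ((c1.const_mul a).sub (c2.const_mul b)).add ((c3.sub continuousOn_const).const_mul σ)
  have hΦα : Φ α = 0 := by simp [hΦ]
  have hincr : ∀ u ∈ Set.Ioo α β', ∀ v ∈ Set.Ioo α β', u ≤ v → X v - X u = Φ v - Φ u := by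
    intro u hu v hv huv
    have mono : ∀ w ∈ Set.Ioo α β', Set.uIcc α w ⊆ Set.uIcc α β' := fun w hw => by
      rw [Set.uIcc_of_le hαβ.le, Set.uIcc_of_le hw.1.le]
      exact Set.Icc_subset_Icc_right hw.2.le
    have e1 := intervalIntegral.integral_interval_sub_left (hfi.mono_set (mono v hv))
      (hfi.mono_set (mono u hu))
    have e2 := intervalIntegral.integral_interval_sub_left (hXi.mono_set (mono v hv))
      (hXi.mono_set (mono u hu))
    rw [(hinterior u hu v hv huv).2, ← e1, ← e2]
    simp only [hΦ]
    ring
  have := left_nhdsWithin_Ioo_neBot hαβ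
  have := right_nhdsWithin_Ioo_neBot hαβ
  have hin : ∀ v ∈ Set.Ioo α β', X v = Φ v := by
    intro v hv
    have l1 : Tendsto (fun u => X v - X u) (nhdsWithin α (Set.Ioo α β')) (nhds (X v - 0)) :=
      limα.const_sub (X v)
    have l2 : Tendsto (fun u => Φ v - Φ u) (nhdsWithin α (Set.Ioo α β')) (nhds (Φ v - Φ α)) :=
      (((hΦc α ⟨le_rfl, hαβ.le⟩).mono Set.Ioo_subset_Icc_self).tendsto).const_sub (Φ v)
    have := tendsto_nhds_unique l1 (l2.congr' ?_)
    · rwa [hΦα, sub_zero, sub_zero] at this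
    · filter_upwards [self_mem_nhdsWithin] with u hu
      rcases le_total u v with huv | huv
      · exact (hincr u hu v hv huv).symm
      · linarith [hincr v hv u hu huv]
  have hend : Φ β' = 0 := by
    have l2 : Tendsto Φ (nhdsWithin β' (Set.Ioo α β')) (nhds (Φ β')) :=
      ((hΦc β' ⟨hαβ.le, le_rfl⟩).mono Set.Ioo_subset_Icc_self).tendsto
    refine tendsto_nhds_unique l2 (limβ.congr' ?_)
    filter_upwards [self_mem_nhdsWithin] with u hu using hin u hu
  intro t ht
  change X t = Φ t
  rcases eq_or_lt_of_le ht.1 with h1 | h1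
  · rw [← h1, hα0, hΦα]
  · rcases eq_or_lt_of_le ht.2 with h2 | h2
    · rw [h2, hβendX, hend]
    · exact hin t ⟨h1, h2⟩
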